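/- Let H = H₁ + ⋯ + H_m be a sum of m Hermitian complex matrices with 0 ≤ Hᵢ ≤ I (both Hᵢ and I − Hᵢ positive semidefinite) for each i, and let ψ be a unit vector that is the unique ground state of H with ground energy λ and spectral gap at least Δ > 0. If ρ is a density matrix with re Tr(ψψ†·ρ) ≤ 1 − ε²/4 for some ε > 0, then there exists an index i with re Tr(Hᵢ·(ρ − ψψ†)) ≥ Δε² / (4m). -/

import Mathlib

open Matrix
open scoped ComplexOrder

/-- If the quadratic form of `A` has nonnegative real part, then so does the trace of the product
of `A` with a positive semidefinite matrix. -/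
theorem Matrix.PosSemidef.re_trace_mul_nonneg {d : Type*} [Fintype d] {A ρ : Matrix d d ℂ}
    (hA : ∀ v : d → ℂ, 0 ≤ (star v ⬝ᵥ (A *ᵥ v)).re) (hρ : ρ.PosSemidef) :
    0 ≤ ((A * ρ).trace).re := by
  obtain ⟨k, v, rfl⟩ := Matrix.posSemidef_iff_eq_sum_vecMulVec.mp hρ
  rw [Matrix.mul_sum, trace_sum, Complex.re_sum]
  refine Finset.sum_nonneg fun i _ => ?_
  rw [mul_vecMulVec, trace_vecMulVec, dotProduct_comm]
  exact hA (v i)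

/-- A Hermitian matrix with ground state `ψ`, ground energy `lam` and spectral gap `Δ` satisfies
`lam + Δ (1 - ψψ†) ≤ H` as quadratic forms. -/
theorem Matrix.IsHermitian.gap_form_nonneg {d : Type*} [Fintype d] [DecidableEq d]
    {H : Matrix d d ℂ} (hH : H.IsHermitian) {ψ : d → ℂ} (hψ : star ψ ⬝ᵥ ψ = 1) {lam Δ : ℝ}
    (hground : H *ᵥ ψ = (lam : ℂ) • ψ)
    (hgap : ∀ v : d → ℂ, star ψ ⬝ᵥ v = 0 →
      (lam + Δ) * (star v ⬝ᵥ v).re ≤ (star v ⬝ᵥ (H *ᵥ v)).re) (v : d → ℂ) :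
    0 ≤ (star v ⬝ᵥ ((H - ((lam + Δ : ℝ) : ℂ) • (1 : Matrix d d ℂ)
      + (Δ : ℂ) • vecMulVec ψ (star ψ)) *ᵥ v)).re := by
  set P := vecMulVec ψ (star ψ) with hP
  have hPH : P.IsHermitian := by
    rw [Matrix.IsHermitian, hP, conjTranspose_vecMulVec, star_star]
  have hPP : P * P = P := by
    rw [hP, vecMulVec_mul_vecMulVec, hψ, one_smul]
  have hHP : H * P = (lam : ℂ) • P := by
    rw [hP, mul_vecMulVec, hground, smul_vecMulVec]
  have hPHl : P * H = (lam : ℂ) • P := by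
    have h : (H * P)ᴴ = ((lam : ℂ) • P)ᴴ := by rw [hHP]
    rwa [conjTranspose_mul, conjTranspose_smul, hPH.eq, hH.eq, Complex.star_def,
      Complex.conj_ofReal] at h
  have hA : H - ((lam + Δ : ℝ) : ℂ) • (1 : Matrix d d ℂ) + (Δ : ℂ) • P
      = (1 - P)ᴴ * ((H - ((lam + Δ : ℝ) : ℂ) • (1 : Matrix d d ℂ)) * (1 - P)) := by
    rw [conjTranspose_sub, conjTranspose_one, hPH.eq]
    simp only [mul_sub, sub_mul, mul_one, one_mul, smul_mul_assoc, mul_smul_comm, hHP, hPHl, hPP]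
    push_cast
    module
  have hperp : star ψ ⬝ᵥ ((1 - P) *ᵥ v) = 0 := by
    rw [sub_mulVec, one_mulVec, hP, vecMulVec_mulVec, dotProduct_sub, op_smul_eq_smul,
      dotProduct_smul, hψ]
    simp
  have hw := hgap _ hperp
  rw [hA, ← mulVec_mulVec, dotProduct_mulVec, ← star_mulVec, ← mulVec_mulVec, sub_mulVec H,
    smul_mulVec, one_mulVec, dotProduct_sub, dotProduct_smul, smul_eq_mul, Complex.sub_re,
    Complex.re_ofReal_mul]
  linarith

/-- Let `H = H₁ + ⋯ + H_m` be a sum of `m` Hermitian matrices with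
`0 ≤ Hᵢ ≤ I`, and let `ψ` be the unique ground state of `H` with ground energy `lam`
and spectral gap at least `Δ > 0`.  If `ρ` is a density matrix with
`re Tr(ψψ†·ρ) ≤ 1 − ε²/4` for some `ε > 0`, then some index `i` satisfies
`re Tr(Hᵢ·(ρ − ψψ†)) ≥ Δε²/(4m)`. -/
theorem exists_local_term_deviation
    {d : Type*} [Fintype d] [DecidableEq d] (m : ℕ)
    (Hs : Fin m → Matrix d d ℂ)
    (hHerm : ∀ i, (Hs i).IsHermitian)
    (hpos : ∀ i, (Hs i).PosSemidef)
    (hle : ∀ i, ((1 : Matrix d d ℂ) - Hs i).PosSemidef)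
    (ψ : d → ℂ) (hψ : star ψ ⬝ᵥ ψ = 1)
    (lam Δ : ℝ) (hΔ : 0 < Δ)
    (hground : (∑ i, Hs i) *ᵥ ψ = (lam : ℂ) • ψ)
    (hgap : ∀ v : d → ℂ, star ψ ⬝ᵥ v = 0 →
      (lam + Δ) * (star v ⬝ᵥ v).re ≤ (star v ⬝ᵥ ((∑ i, Hs i) *ᵥ v)).re)
    (ρ : Matrix d d ℂ) (hρ : ρ.PosSemidef) (hρtr : ρ.trace = 1)
    (ε : ℝ) (hε : 0 < ε)
    (hfar : ((vecMulVec ψ (star ψ) * ρ).trace).re ≤ 1 - ε ^ 2 / 4) :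
    ∃ i, Δ * ε ^ 2 / (4 * m) ≤ ((Hs i * (ρ - vecMulVec ψ (star ψ))).trace).re := by
  set H := ∑ i, Hs i with hHdef
  set P := vecMulVec ψ (star ψ) with hP
  have hH : H.IsHermitian := by
    rw [Matrix.IsHermitian, hHdef, conjTranspose_sum]
    exact Finset.sum_congr rfl fun i _ => (hHerm i).eq
  have key := hρ.re_trace_mul_nonneg (hH.gap_form_nonneg hψ hground hgap)
  rw [← hP, add_mul, sub_mul, smul_mul_assoc, smul_mul_assoc, one_mul, trace_add, trace_sub,
    trace_smul, trace_smul, hρtr, Complex.add_re, Complex.sub_re, smul_eq_mul, smul_eq_mul,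
    Complex.re_ofReal_mul, Complex.re_ofReal_mul, Complex.one_re] at key
  have hHP : ((H * P).trace).re = lam := by
    rw [hP, mul_vecMulVec, hground, smul_vecMulVec, trace_smul, trace_vecMulVec,
      dotProduct_comm, hψ]
    simp
  have htotal : Δ * ε ^ 2 / 4 ≤ ∑ i, ((Hs i * (ρ - P)).trace).re := by
    rw [← Complex.re_sum, ← trace_sum, ← Finset.sum_mul, ← hHdef, mul_sub, trace_sub,
      Complex.sub_re, hHP]
    nlinarith [mul_le_mul_of_nonneg_left hfar hΔ.le]
  have hpos' : 0 < Δ * ε ^ 2 / 4 := by positivity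
  by_contra! hlt
  rcases Nat.eq_zero_or_pos m with rfl | hm
  · simp only [Finset.univ_eq_empty, Finset.sum_empty] at htotal
    linarith
  · have hne : (Finset.univ : Finset (Fin m)).Nonempty := ⟨⟨0, hm⟩, Finset.mem_univ _⟩
    have hsum := Finset.sum_lt_sum_of_nonempty hne fun i _ => hlt i
    have hconst : ∑ _i : Fin m, Δ * ε ^ 2 / (4 * m) = Δ * ε ^ 2 / 4 := by
      have : (m : ℝ) ≠ 0 := by positivity
      rw [Finset.sum_const, Finset.card_univ, Fintype.card_fin, nsmul_eq_mul]
      field_simp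
    linarith
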